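/- Let x_1, …, x_{N+1} ∈ ℝ^d be data points, ψ : ℝ → ℝ with |ψ(s)| ≤ h for all s ∈ ℝ, applied entrywise, W ∈ ℝ^{m×d} fixed, and F(W,K) = (1/(2N)) Σ_{i=1}^N ‖ψ(W x_{i+1}) − K ψ(W x_i)‖₂². Then for all K¹, K² ∈ ℝ^{m×m}: ‖∇_K F(W,K¹) − ∇_K F(W,K²)‖_F ≤ m h² ‖K¹ − K²‖_F, i.e., K ↦ ∇_K F(W,K) is Lipschitz with constant L_K = m h². -/

import Mathlib

open scoped BigOperators

/-- The Koopman operator learning objective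
`F(W,K) = (1/(2N)) ∑ᵢ ‖ψ(W x_{i+1}) − K ψ(W x_i)‖₂²`. -/
noncomputable def koopF {N d m : ℕ} (x : Fin (N + 1) → Fin d → ℝ) (ψ : ℝ → ℝ)
    (W : EuclideanSpace ℝ (Fin m × Fin d)) (K : EuclideanSpace ℝ (Fin m × Fin m)) : ℝ :=
  (1 / (2 * (N : ℝ))) * ∑ i : Fin N, ∑ j : Fin m,
    (ψ (∑ k : Fin d, W (j, k) * x i.succ k)
      - ∑ l : Fin m, K (j, l) * ψ (∑ k : Fin d, W (l, k) * x i.castSucc k)) ^ 2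

/-- The gradient of a least-squares residual `K ↦ c ∑ᵢ ‖yᵢ − K uᵢ‖²` with respect to the
matrix `K`. -/
theorem hasGradientAt_leastSquares {ι m : Type*} [Fintype ι] [Fintype m] (c : ℝ)
    (y u : ι → m → ℝ) (K : EuclideanSpace ℝ (m × m)) :
    HasGradientAt
      (fun K : EuclideanSpace ℝ (m × m) => c * ∑ i, ∑ j, (y i j - ∑ l, K (j, l) * u i l) ^ 2)
      ((-(2 * c)) • ∑ i, WithLp.toLp 2
        (fun p : m × m => (y i p.1 - ∑ l, K (p.1, l) * u i l) * u i p.2)) K := by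
  have hproj (p : m × m) : HasFDerivAt (fun K : EuclideanSpace ℝ (m × m) => K p)
      (EuclideanSpace.proj p : EuclideanSpace ℝ (m × m) →L[ℝ] ℝ) K :=
    (EuclideanSpace.proj p : EuclideanSpace ℝ (m × m) →L[ℝ] ℝ).hasFDerivAt
  rw [hasGradientAt_iff_hasFDerivAt]
  refine ((HasFDerivAt.fun_sum fun i _ => HasFDerivAt.fun_sum fun j _ =>
    ((HasFDerivAt.fun_sum fun l _ => (hproj (j, l)).mul_const (u i l)).const_sub
      (y i j)).pow 2).const_mul c).congr_fderiv ?_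
  ext V
  simp only [map_smul, map_sum, smul_apply, sum_apply,
    neg_apply, InnerProductSpace.toDual_apply_apply, PiLp.inner_apply,
    PiLp.proj_apply, Fintype.sum_prod_type, smul_eq_mul, Finset.mul_sum,
    RCLike.inner_apply, conj_trivial, nsmul_eq_mul, ← Finset.sum_neg_distrib]
  refine Finset.sum_congr rfl fun i _ => Finset.sum_congr rfl fun j _ =>
    Finset.sum_congr rfl fun l _ => ?_
  push_cast
  ring

/-- The map `V ↦ (V u) uᵀ` has Frobenius operator norm at most `‖u‖₂²`. -/
theorem norm_mulVec_vecMulVec_le {m : Type*} [Fintype m] (u : m → ℝ)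
    (V : EuclideanSpace ℝ (m × m)) :
    ‖(WithLp.toLp 2 (fun p : m × m => (∑ l, V (p.1, l) * u l) * u p.2) :
      EuclideanSpace ℝ (m × m))‖ ≤ (∑ l, u l ^ 2) * ‖V‖ := by
  have hu : 0 ≤ ∑ l, u l ^ 2 := Finset.sum_nonneg fun l _ => sq_nonneg _
  refine le_of_sq_le_sq ?_ (mul_nonneg hu (norm_nonneg V))
  rw [mul_pow, EuclideanSpace.real_norm_sq_eq, EuclideanSpace.real_norm_sq_eq,
    Fintype.sum_prod_type, Fintype.sum_prod_type, Finset.mul_sum]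
  refine Finset.sum_le_sum fun j _ => ?_
  simp only [mul_pow, ← Finset.mul_sum]
  have hcs := Finset.sum_mul_sq_le_sq_mul_sq Finset.univ (fun l => V (j, l)) u
  calc _ ≤ ((∑ l, V (j, l) ^ 2) * ∑ l, u l ^ 2) * ∑ l, u l ^ 2 :=
        mul_le_mul_of_nonneg_right hcs hu
    _ = _ := by ring

/-- If `|ψ| ≤ h`, then for fixed `W` the map `K ↦ ∇_K F(W,K)` is Lipschitz with
constant `L_K = m h²` (Frobenius norms). -/
theorem gradient_K_lipschitz {N d m : ℕ} (hN : 0 < N) (x : Fin (N + 1) → Fin d → ℝ)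
    (ψ : ℝ → ℝ) (h : ℝ) (hψ : ∀ s : ℝ, |ψ s| ≤ h)
    (W : EuclideanSpace ℝ (Fin m × Fin d)) :
    ∀ K₁ K₂ : EuclideanSpace ℝ (Fin m × Fin m),
      ‖gradient (fun K => koopF x ψ W K) K₁ - gradient (fun K => koopF x ψ W K) K₂‖
        ≤ (m : ℝ) * h ^ 2 * ‖K₁ - K₂‖ := by
  intro K₁ K₂
  set u : Fin N → Fin m → ℝ := fun i l => ψ (∑ k : Fin d, W (l, k) * x i.castSucc k)
  have hgrad (K : EuclideanSpace ℝ (Fin m × Fin m)) :=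
    (hasGradientAt_leastSquares (1 / (2 * (N : ℝ)))
      (fun i j => ψ (∑ k : Fin d, W (j, k) * x i.succ k)) u K).gradient
  have hbound (i : Fin N) : ∑ l, u i l ^ 2 ≤ (m : ℝ) * h ^ 2 := by
    have hle := Finset.sum_le_sum fun l (_ : l ∈ Finset.univ) =>
      sq_le_sq' (neg_le_of_abs_le (hψ (∑ k : Fin d, W (l, k) * x i.castSucc k)))
        (le_of_abs_le (hψ (∑ k : Fin d, W (l, k) * x i.castSucc k)))
    simpa using hle
  have hN' : (N : ℝ) ≠ 0 := by positivity
  have hdiff : gradient (fun K => koopF x ψ W K) K₁ - gradient (fun K => koopF x ψ W K) K₂ =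
      (N : ℝ)⁻¹ • ∑ i, WithLp.toLp 2
        (fun p : Fin m × Fin m => (∑ l, (K₁ - K₂) (p.1, l) * u i l) * u i p.2) := by
    unfold koopF
    rw [hgrad K₁, hgrad K₂, ← smul_sub, ← Finset.sum_sub_distrib,
      show -(2 * (1 / (2 * (N : ℝ)))) = -(N : ℝ)⁻¹ by field_simp, neg_smul, ← smul_neg,
      ← Finset.sum_neg_distrib]
    congr 1
    refine Finset.sum_congr rfl fun i _ => ?_
    ext p
    simp only [PiLp.neg_apply, PiLp.sub_apply, sub_mul, Finset.sum_sub_distrib]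
    ring
  rw [hdiff, norm_smul, norm_inv, Real.norm_natCast, inv_mul_le_iff₀ (by positivity)]
  calc _ ≤ ∑ _i : Fin N, (m : ℝ) * h ^ 2 * ‖K₁ - K₂‖ :=
        norm_sum_le_of_le _ fun i _ => (norm_mulVec_vecMulVec_le (u i) _).trans
          (mul_le_mul_of_nonneg_right (hbound i) (norm_nonneg _))
    _ = _ := by simp
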